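/- For every z ∈ ℂ^m, with z_□ := (Re z, Im z) ∈ ℝ^{2m}, the following three conditions are equivalent: (i) the weighted-least-squares residual r(z_□) := G_□ z_□ equals 0; (ii) Fz = 0; (iii) Rz = 0. -/

import Mathlib

open Matrix

/-- The least-squares verification matrix `F := H (Hᴴ H)⁻¹ Hᴴ - Id`. -/
noncomputable def verif {m n : ℕ} (H : Matrix (Fin m) (Fin n) ℂ) :
    Matrix (Fin m) (Fin m) ℂ :=
  H * (Hᴴ * H)⁻¹ * Hᴴ - 1

/-- The realification `H_□ = [[Re H, −Im H],[Im H, Re H]]` of a complex matrix. -/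
def realify {m n : ℕ} (H : Matrix (Fin m) (Fin n) ℂ) :
    Matrix (Fin m ⊕ Fin m) (Fin n ⊕ Fin n) ℝ :=
  Matrix.fromBlocks (H.map Complex.re) (-(H.map Complex.im))
    (H.map Complex.im) (H.map Complex.re)

/-- The rectangular coordinates `z_□ = (Re z, Im z)` of a complex vector. -/
def rectVec {m : ℕ} (z : Fin m → ℂ) : Fin m ⊕ Fin m → ℝ :=
  Sum.elim (fun i => (z i).re) (fun i => (z i).im)

/-- The weighted-least-squares verification matrix
`G_□ := H_□ (H_□ᵀ C⁻¹ H_□)⁻¹ H_□ᵀ C⁻¹ - Id`. -/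
noncomputable def Gbox {m n : ℕ} (H : Matrix (Fin m) (Fin n) ℂ)
    (C : Matrix (Fin m ⊕ Fin m) (Fin m ⊕ Fin m) ℝ) :
    Matrix (Fin m ⊕ Fin m) (Fin m ⊕ Fin m) ℝ :=
  realify H * ((realify H)ᵀ * C⁻¹ * realify H)⁻¹ * (realify H)ᵀ * C⁻¹ - 1

/-- The complex matrix `R := (1/2)·[[G1 − i·G2],[G3 − i·G4]]` built by vertically stacking
blocks of `G_□ = [[G1, G2],[G3, G4]]`. -/
noncomputable def Rmat {m n : ℕ} (H : Matrix (Fin m) (Fin n) ℂ)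
    (C : Matrix (Fin m ⊕ Fin m) (Fin m ⊕ Fin m) ℝ) :
    Matrix (Fin m ⊕ Fin m) (Fin m) ℂ :=
  (1 / 2 : ℂ) • Matrix.fromRows
    ((Gbox H C).toBlocks₁₁.map (Complex.ofReal) -
      Complex.I • (Gbox H C).toBlocks₁₂.map (Complex.ofReal))
    ((Gbox H C).toBlocks₂₁.map (Complex.ofReal) -
      Complex.I • (Gbox H C).toBlocks₂₂.map (Complex.ofReal))

theorem Matrix.mulVec_mul_inv_mul_sub_one_eq_zero_iff {α β K : Type*} [Fintype α] [DecidableEq α]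
    [Fintype β] [DecidableEq β] [CommRing K] (A : Matrix α β K) (B : Matrix β α K)
    (h : IsUnit (B * A)) (z : α → K) :
    (A * (B * A)⁻¹ * B - 1) *ᵥ z = 0 ↔ ∃ x, A *ᵥ x = z := by
  rw [sub_mulVec, one_mulVec, sub_eq_zero]
  constructor
  · intro hz
    exact ⟨((B * A)⁻¹ * B) *ᵥ z, by rw [mulVec_mulVec, ← Matrix.mul_assoc, hz]⟩
  · rintro ⟨x, rfl⟩
    rw [mulVec_mulVec, Matrix.mul_assoc, Matrix.mul_assoc,
      nonsing_inv_mul _ ((isUnit_iff_isUnit_det _).mp h), Matrix.mul_one]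

theorem Matrix.mulVec_injective_of_rank_eq {m n : ℕ} {K : Type*} [Field K]
    (A : Matrix (Fin m) (Fin n) K) (h : A.rank = n) : Function.Injective A.mulVec := by
  rw [mulVec_injective_iff, linearIndependent_iff_card_eq_finrank_span, Fintype.card_fin,
    Set.finrank, ← rank_eq_finrank_span_cols, h]

theorem rectVec_injective {m : ℕ} : Function.Injective (rectVec (m := m)) := by
  intro x y h
  ext i
  exact Complex.ext (congrFun h (Sum.inl i)) (congrFun h (Sum.inr i))

theorem rectVec_surjective {m : ℕ} : Function.Surjective (rectVec (m := m)) := by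
  intro v
  refine ⟨fun i => ⟨v (Sum.inl i), v (Sum.inr i)⟩, ?_⟩
  ext (i | i) <;> rfl

theorem realify_mulVec_rectVec {m n : ℕ} (H : Matrix (Fin m) (Fin n) ℂ) (x : Fin n → ℂ) :
    realify H *ᵥ rectVec x = rectVec (H *ᵥ x) := by
  ext (i | i) <;>
    simp [realify, rectVec, mulVec, dotProduct, Finset.sum_add_distrib,
      sub_eq_add_neg, add_comm]

theorem realify_mulVec_injective {m n : ℕ} {H : Matrix (Fin m) (Fin n) ℂ}
    (h : Function.Injective H.mulVec) : Function.Injective (realify H).mulVec := by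
  intro v w hvw
  obtain ⟨x, rfl⟩ := rectVec_surjective v
  obtain ⟨y, rfl⟩ := rectVec_surjective w
  rw [realify_mulVec_rectVec, realify_mulVec_rectVec] at hvw
  rw [h (rectVec_injective hvw)]

theorem verif_mulVec_eq_zero_iff {m n : ℕ} {H : Matrix (Fin m) (Fin n) ℂ}
    (h : Function.Injective H.mulVec) (z : Fin m → ℂ) :
    verif H *ᵥ z = 0 ↔ ∃ x, H *ᵥ x = z :=
  mulVec_mul_inv_mul_sub_one_eq_zero_iff H Hᴴ
    (open scoped ComplexOrder in (PosDef.conjTranspose_mul_self H h).isUnit) z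

theorem Gbox_mulVec_rectVec_eq_zero_iff {m n : ℕ} {H : Matrix (Fin m) (Fin n) ℂ}
    (h : Function.Injective H.mulVec)
    {C : Matrix (Fin m ⊕ Fin m) (Fin m ⊕ Fin m) ℝ} (hC : C.PosDef) (z : Fin m → ℂ) :
    Gbox H C *ᵥ rectVec z = 0 ↔ ∃ x, H *ᵥ x = z := by
  have hu : IsUnit ((realify H)ᵀ * C⁻¹ * realify H) := by
    have := hC.inv.conjTranspose_mul_mul_same (realify_mulVec_injective h)
    rw [conjTranspose_eq_transpose_of_trivial] at this
    exact this.isUnit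
  rw [Gbox, Matrix.mul_assoc _ (realify H)ᵀ, mulVec_mul_inv_mul_sub_one_eq_zero_iff _ _ hu]
  constructor
  · rintro ⟨v, hv⟩
    obtain ⟨x, rfl⟩ := rectVec_surjective v
    rw [realify_mulVec_rectVec] at hv
    exact ⟨x, rectVec_injective hv⟩
  · rintro ⟨x, rfl⟩
    exact ⟨rectVec x, realify_mulVec_rectVec H x⟩

theorem Rmat_mulVec_apply {m n : ℕ} (H : Matrix (Fin m) (Fin n) ℂ)
    (C : Matrix (Fin m ⊕ Fin m) (Fin m ⊕ Fin m) ℝ) (z : Fin m → ℂ) (k : Fin m ⊕ Fin m) :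
    (Rmat H C *ᵥ z) k =
      ⟨(Gbox H C *ᵥ rectVec z) k / 2, -(Gbox H C *ᵥ rectVec (Complex.I • z)) k / 2⟩ := by
  rcases k with k | k <;> apply Complex.ext <;>
    simp only [Rmat, rectVec, mulVec, dotProduct, Fintype.sum_sum_type, neg_div,
      ← Finset.sum_add_distrib, Finset.sum_div, ← Finset.sum_neg_distrib, Complex.re_sum,
      Complex.im_sum] <;>
    refine Finset.sum_congr rfl fun i _ => ?_ <;>
    simp [toBlocks₁₁, toBlocks₁₂, toBlocks₂₁, toBlocks₂₂] <;> ring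

theorem Rmat_mulVec_eq_zero_iff {m n : ℕ} (H : Matrix (Fin m) (Fin n) ℂ)
    (C : Matrix (Fin m ⊕ Fin m) (Fin m ⊕ Fin m) ℝ) (z : Fin m → ℂ) :
    Rmat H C *ᵥ z = 0 ↔
      Gbox H C *ᵥ rectVec z = 0 ∧ Gbox H C *ᵥ rectVec (Complex.I • z) = 0 := by
  simp [funext_iff, -Sum.forall, Rmat_mulVec_apply, Complex.ext_iff, forall_and]

/-- The three conditions `G_□ z_□ = 0`, `Fz = 0`, and `Rz = 0` are equivalent. -/
theorem stmt3 {m n : ℕ} (H : Matrix (Fin m) (Fin n) ℂ) (hH : H.rank = n)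
    (C : Matrix (Fin m ⊕ Fin m) (Fin m ⊕ Fin m) ℝ) (hC : C.PosDef)
    (z : Fin m → ℂ) :
    ((Gbox H C).mulVec (rectVec z) = 0 ↔ (verif H).mulVec z = 0) ∧
      ((verif H).mulVec z = 0 ↔ (Rmat H C).mulVec z = 0) := by
  have h := mulVec_injective_of_rank_eq H hH
  rw [Rmat_mulVec_eq_zero_iff, verif_mulVec_eq_zero_iff h, Gbox_mulVec_rectVec_eq_zero_iff h hC,
    Gbox_mulVec_rectVec_eq_zero_iff h hC]
  refine ⟨Iff.rfl, fun hz => ⟨hz, ?_⟩, And.left⟩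
  obtain ⟨x, rfl⟩ := hz
  exact ⟨Complex.I • x, mulVec_smul _ _ _⟩
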